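/- If a finite undirected graph G is a direct minor of a finite undirected graph H, i.e. G is obtained from H by a single operation of edge deletion, edge contraction, or deletion of an isolated vertex, then Ent(H) − 1 ≤ Ent(G). -/

import Mathlib

/-!
The entanglement game `Ent(G,k)` on a graph with adjacency relation
`E : V → V → Prop` is played by Robber against `k` cops.  Positions are
`(v, C, P)` with `v : V`, `C : Finset V` with `C.card ≤ k`, and
`P ∈ {Cops, Robber}`.  Initially Robber chooses `v₀` and moves to
`(v₀, ∅, Cops)`.  From `(v, C, Cops)`, Cops may skip, add a cop on `v`
(if at most `k` cops are then placed), or move a placed cop to `v`; from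
`(v, C, Robber)`, Robber moves along an edge to a vertex free of cops.
Every finite play is a win for Cops, so "Cops have a winning strategy from
`(v, C, Cops)`" is the inductive predicate `EntCopsWinFrom`.  The
entanglement of the graph is the least `k` such that Cops have a winning
strategy in `Ent(G,k)` (it is at most the number of vertices).
-/

variable {V : Type*} [DecidableEq V]

/-- A legal Cops move in the game `Ent(G,k)`: from position `(v, C, Cops)`
Cops may go to `(v, C', Robber)` where `C'` is `C` (skip), `C ∪ {v}` provided
at most `k` cops are used (add), or `(C \ {x}) ∪ {v}` for some `x ∈ C`
(move a placed cop). -/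
def EntCopsMove (k : ℕ) (v : V) (C C' : Finset V) : Prop :=
  C' = C ∨ (C' = insert v C ∧ (insert v C).card ≤ k) ∨
    ∃ x ∈ C, C' = insert v (C.erase x)

/-- Cops have a winning strategy in `Ent(G,k)` from position `(v, C, Cops)`. -/
inductive EntCopsWinFrom (E : V → V → Prop) (k : ℕ) : V → Finset V → Prop
  | step (v : V) (C C' : Finset V) (hmove : EntCopsMove k v C C')
      (h : ∀ v', E v v' → v' ∉ C' → EntCopsWinFrom E k v' C') :
      EntCopsWinFrom E k v C

/-- Cops have a winning strategy in the game `Ent(G,k)`. -/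
def EntCopsWin (E : V → V → Prop) (k : ℕ) : Prop :=
  ∀ v : V, EntCopsWinFrom E k v ∅

/-- The entanglement of a graph: the least number `k` of cops such that Cops
have a winning strategy in the game `Ent(G,k)`. -/
noncomputable def entanglement (E : V → V → Prop) : ℕ :=
  sInf {k | EntCopsWin E k}

universe u

/-- A finite undirected graph, bundled with its (finite, decidable) vertex
type. -/
structure FinGraph : Type (u + 1) where
  V : Type u
  [instFintype : Fintype V]
  [instDecEq : DecidableEq V]
  G : SimpleGraph V

attribute [instance] FinGraph.instFintype FinGraph.instDecEq

/-- The entanglement of a bundled finite graph. -/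
noncomputable def FinGraph.ent (X : FinGraph) : ℕ :=
  entanglement X.G.Adj

/-- `X` is obtained from `Y` by deleting one edge. -/
def FinGraph.IsEdgeDeletion (X Y : FinGraph) : Prop :=
  ∃ a b : Y.V, Y.G.Adj a b ∧ Nonempty (X.G ≃g Y.G.deleteEdges {s(a, b)})

/-- `X` is obtained from `Y` by contracting one edge `ab` to a new vertex `z`
which inherits all the neighbours of `a` and `b`; the contraction is
witnessed by the surjection `f` identifying exactly `a` and `b`. -/
def FinGraph.IsEdgeContraction (X Y : FinGraph) : Prop :=
  ∃ (a b : Y.V) (z : X.V) (f : Y.V → X.V),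
    Y.G.Adj a b ∧ f a = z ∧ f b = z ∧ Function.Surjective f ∧
    (∀ u v : Y.V, u ≠ v → f u = f v → (u = a ∧ v = b) ∨ (u = b ∧ v = a)) ∧
    (∀ x y : X.V,
      X.G.Adj x y ↔ x ≠ y ∧ ∃ u v : Y.V, f u = x ∧ f v = y ∧ Y.G.Adj u v)

/-- `X` is obtained from `Y` by deleting one isolated vertex. -/
def FinGraph.IsIsolatedVertexDeletion (X Y : FinGraph) : Prop :=
  ∃ v : Y.V, (∀ w, ¬ Y.G.Adj v w) ∧
    Nonempty (X.G ≃g Y.G.induce ({v}ᶜ : Set Y.V))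

/-- `X` is a direct minor of `Y`: it is obtained from `Y` by a single
operation of edge deletion, edge contraction, or deletion of an isolated
vertex. -/
def FinGraph.DirectMinor (X Y : FinGraph) : Prop :=
  X.IsEdgeDeletion Y ∨ X.IsEdgeContraction Y ∨ X.IsIsolatedVertexDeletion Y

/-- `X` is a minor of `Y`: it is obtained from `Y` by successive edge
deletions, edge contractions and deletions of isolated vertices. -/
def FinGraph.IsMinor (X Y : FinGraph) : Prop :=
  Relation.ReflTransGen FinGraph.DirectMinor X Y

/-- `X` is a proper minor of `Y`: a minor obtained by at least one
operation. -/
def FinGraph.ProperMinor (X Y : FinGraph) : Prop :=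
  Relation.TransGen FinGraph.DirectMinor X Y

/-- Cops win from `(v, C, Cops)` in the relaxed game in which, in one turn, they may remove any
number of cops and place one on the current vertex. -/
inductive EntCopsWinRelaxed (E : V → V → Prop) (k : ℕ) : V → Finset V → Prop
  | step (v : V) (C D : Finset V) (hsub : D ⊆ insert v C) (hcard : D.card ≤ k)
      (h : ∀ v', E v v' → v' ∉ D → EntCopsWinRelaxed E k v' D) :
      EntCopsWinRelaxed E k v C

theorem EntCopsMove.subset_insert {k : ℕ} {v : V} {C D : Finset V} (h : EntCopsMove k v C D) :
    D ⊆ insert v C := by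
  rcases h with rfl | ⟨rfl, -⟩ | ⟨x, -, rfl⟩
  · exact Finset.subset_insert _ _
  · exact Finset.Subset.refl _
  · exact Finset.insert_subset_insert _ (Finset.erase_subset _ _)

theorem EntCopsMove.card_le {k : ℕ} {v : V} {C D : Finset V} (h : EntCopsMove k v C D)
    (hC : C.card ≤ k) : D.card ≤ k := by
  rcases h with rfl | ⟨rfl, h⟩ | ⟨x, hx, rfl⟩
  · exact hC
  · exact h
  · have := Finset.card_insert_le v (C.erase x)
    have := Finset.card_erase_add_one hx
    omega

/-- A legal Cops move can cover any set of at most `k` vertices contained in `insert v C`. -/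
theorem exists_entCopsMove_superset {k : ℕ} {v : V} {C D : Finset V}
    (hD : D.card ≤ k) (hsub : D ⊆ insert v C) :
    ∃ C', EntCopsMove k v C C' ∧ D ⊆ C' := by
  by_cases hDC : D ⊆ C
  · exact ⟨C, Or.inl rfl, hDC⟩
  have hvD : v ∈ D := by
    by_contra hv
    exact hDC ((Finset.subset_insert_iff_of_notMem hv).1 hsub)
  by_cases hk : (insert v C).card ≤ k
  · exact ⟨insert v C, Or.inr (Or.inl ⟨rfl, hk⟩), hsub⟩
  have hCD : ¬ C ⊆ D := fun hCD =>
    hk ((Finset.card_le_card (Finset.insert_subset hvD hCD)).trans hD)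
  obtain ⟨x, hxC, hxD⟩ := Finset.not_subset.1 hCD
  refine ⟨insert v (C.erase x), Or.inr (Or.inr ⟨x, hxC, rfl⟩), fun u hu => ?_⟩
  have := hsub hu
  have : u ≠ x := fun h => hxD (h ▸ hu)
  simp_all

theorem EntCopsWinFrom.relaxed {E : V → V → Prop} {k : ℕ} {v : V} {C : Finset V}
    (h : EntCopsWinFrom E k v C) (hC : C.card ≤ k) : EntCopsWinRelaxed E k v C := by
  induction h with
  | step v C D hmove _ ih =>
    exact .step v C D hmove.subset_insert (hmove.card_le hC)
      fun v' he hv' => ih v' he hv' (hmove.card_le hC)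

theorem EntCopsWinRelaxed.winFrom_of_subset {E : V → V → Prop} {k : ℕ} {v : V} {C : Finset V}
    (h : EntCopsWinRelaxed E k v C) {C' : Finset V} (hsub : C ⊆ C') (hC' : C'.card ≤ k) :
    EntCopsWinFrom E k v C' := by
  induction h generalizing C' with
  | step v C D hD hcard _ ih =>
    obtain ⟨D', hmove, hDD'⟩ :=
      exists_entCopsMove_superset hcard (hD.trans (Finset.insert_subset_insert v hsub))
    exact .step v C' D' hmove fun v' he hv' =>
      ih v' he (fun hv => hv' (hDD' hv)) hDD' (hmove.card_le hC')

theorem entCopsWin_iff_relaxed {E : V → V → Prop} {k : ℕ} :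
    EntCopsWin E k ↔ ∀ v, EntCopsWinRelaxed E k v ∅ :=
  ⟨fun h v => (h v).relaxed (by simp),
    fun h v => (h v).winFrom_of_subset (Finset.Subset.refl _) (by simp)⟩

theorem entCopsWinRelaxed_card [Fintype V] (E : V → V → Prop) {v : V} {C : Finset V}
    (hv : v ∉ C) : EntCopsWinRelaxed E (Fintype.card V) v C := by
  induction hn : Fintype.card V - C.card using Nat.strong_induction_on generalizing v C with
  | _ n ih =>
    refine .step v C (insert v C) (Finset.Subset.refl _) (Finset.card_le_univ _)
      fun v' _ hv' => ih _ ?_ hv' rfl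
    have := Finset.card_insert_of_notMem hv
    have := Finset.card_le_univ (insert v C)
    omega

theorem entCopsWin_card [Fintype V] (E : V → V → Prop) : EntCopsWin E (Fintype.card V) :=
  entCopsWin_iff_relaxed.2 fun _ => entCopsWinRelaxed_card E (by simp)

theorem EntCopsWinRelaxed.of_injective {W : Type*} [DecidableEq W] {E : V → V → Prop}
    {F : W → W → Prop} {k : ℕ} {f : V → W} (hf : Function.Injective f)
    (hE : ∀ u v, E u v → F (f u) (f v)) {w : W} {C : Finset W}
    (h : EntCopsWinRelaxed F k w C) {v : V} (hv : f v = w) :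
    EntCopsWinRelaxed E k v (C.preimage f hf.injOn) := by
  induction h generalizing v with
  | step w C D hD hcard _ ih =>
    subst hv
    refine .step v _ (D.preimage f hf.injOn) (fun u hu => ?_) ?_ fun v' he hv' => ?_
    · have := hD (Finset.mem_preimage.1 hu)
      simpa [hf.eq_iff] using this
    · exact (Finset.card_le_card_of_injOn f (fun u hu => Finset.mem_preimage.1 hu)
        hf.injOn).trans hcard
    · exact ih (f v') (hE _ _ he) (by simpa using hv') rfl

/-- Entanglement is monotone under (not necessarily induced) subgraphs. -/
theorem EntCopsWin.of_injective {W : Type*} [DecidableEq W] {E : V → V → Prop}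
    {F : W → W → Prop} {k : ℕ} {f : V → W} (hf : Function.Injective f)
    (hE : ∀ u v, E u v → F (f u) (f v)) (h : EntCopsWin F k) : EntCopsWin E k :=
  entCopsWin_iff_relaxed.2 fun v => by
    simpa using (entCopsWin_iff_relaxed.1 h (f v)).of_injective hf hE rfl

theorem EntCopsWinRelaxed.insert_of_subtype {E : V → V → Prop} {k : ℕ} {a : V}
    {v : {u // u ≠ a}} {C : Finset {u // u ≠ a}}
    (h : EntCopsWinRelaxed (fun x y : {u // u ≠ a} => E x y) k v C) :
    EntCopsWinRelaxed E (k + 1) v (insert a (C.map (Function.Embedding.subtype _))) := by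
  induction h with
  | step v C D hD hcard _ ih =>
    refine .step _ _ (insert a (D.map (Function.Embedding.subtype _))) ?_ ?_ fun v' he hv' => ?_
    · rw [Finset.insert_comm]
      refine Finset.insert_subset_insert _ ?_
      simpa using Finset.map_subset_map (f := Function.Embedding.subtype (· ≠ a)) |>.2 hD
    · have := Finset.card_insert_le a (D.map (Function.Embedding.subtype _))
      rw [Finset.card_map] at this
      omega
    · have hne : v' ≠ a := fun h => hv' (by simp [h])
      exact ih ⟨v', hne⟩ he fun hm =>
        hv' (Finset.mem_insert_of_mem (Finset.mem_map_of_mem (Function.Embedding.subtype _) hm))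

theorem EntCopsWin.relaxed_at_deleted {E : V → V → Prop} {k : ℕ} {a : V}
    (h : EntCopsWin (fun x y : {u // u ≠ a} => E x y) k) (C : Finset V) :
    EntCopsWinRelaxed E (k + 1) a C := by
  refine .step a C {a} (by simp) (by simp) fun v _ hv => ?_
  simpa using (entCopsWin_iff_relaxed.1 h ⟨v, by simpa using hv⟩).insert_of_subtype

theorem EntCopsWinRelaxed.of_subtype {E : V → V → Prop} {k : ℕ} {a : V}
    (hwin : EntCopsWin (fun x y : {u // u ≠ a} => E x y) k)
    {v : {u // u ≠ a}} {C : Finset {u // u ≠ a}}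
    (h : EntCopsWinRelaxed (fun x y : {u // u ≠ a} => E x y) k v C) :
    EntCopsWinRelaxed E (k + 1) v (C.map (Function.Embedding.subtype _)) := by
  induction h with
  | step v C D hD hcard _ ih =>
    refine .step _ _ (D.map (Function.Embedding.subtype _)) ?_ ?_ fun v' he hv' => ?_
    · simpa using Finset.map_subset_map (f := Function.Embedding.subtype (· ≠ a)) |>.2 hD
    · rw [Finset.card_map]
      omega
    · by_cases hne : v' = a
      · subst hne
        exact hwin.relaxed_at_deleted _
      · exact ih ⟨v', hne⟩ he fun hm =>
          hv' (Finset.mem_map_of_mem (Function.Embedding.subtype _) hm)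

/-- Deleting one vertex decreases the entanglement by at most one. -/
theorem EntCopsWin.of_subtype {E : V → V → Prop} {k : ℕ} {a : V}
    (h : EntCopsWin (fun x y : {u // u ≠ a} => E x y) k) : EntCopsWin E (k + 1) :=
  entCopsWin_iff_relaxed.2 fun v => by
    by_cases hv : v = a
    · subst hv
      exact h.relaxed_at_deleted _
    · simpa using (entCopsWin_iff_relaxed.1 h ⟨v, hv⟩).of_subtype h

/-- A direct minor of `H` contains, as a subgraph, `H` with some vertex deleted. -/
theorem FinGraph.DirectMinor.exists_vertex_deletion {G H : FinGraph} (h : G.DirectMinor H) :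
    ∃ (a : H.V) (f : {u // u ≠ a} → G.V), Function.Injective f ∧
      ∀ u v : {u // u ≠ a}, H.G.Adj u v → G.G.Adj (f u) (f v) := by
  rcases h with ⟨a, b, -, ⟨e⟩⟩ | ⟨a, b, z, f, -, -, -, -, hinj, hadj⟩ | ⟨a, -, ⟨e⟩⟩
  · refine ⟨a, fun u => e.symm u, e.symm.injective.comp Subtype.val_injective,
      fun u v huv => e.symm.map_adj_iff.2 ?_⟩
    rw [SimpleGraph.deleteEdges_adj]
    refine ⟨huv, fun hab => ?_⟩
    have ha : a ∈ s((u : H.V), (v : H.V)) := by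
      rw [Set.mem_singleton_iff.1 hab]
      exact Sym2.mem_mk_left a b
    rcases Sym2.mem_iff.1 ha with h | h
    · exact u.2 h.symm
    · exact v.2 h.symm
  · have hf : Function.Injective fun u : {u // u ≠ a} => f u := by
      intro u v huv
      by_contra hne
      rcases hinj u v (fun h => hne (Subtype.ext h)) huv with ⟨h, -⟩ | ⟨-, h⟩
      · exact u.2 h
      · exact v.2 h
    exact ⟨a, fun u => f u, hf, fun u v huv => (hadj _ _).2
      ⟨fun h => huv.ne (congrArg Subtype.val (hf h)), u, v, rfl, rfl, huv⟩⟩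
  · refine ⟨a, fun u => e.symm ⟨u, u.2⟩, fun u v huv => ?_, fun u v huv => ?_⟩
    · exact Subtype.ext (congrArg Subtype.val (e.symm.injective huv))
    · exact e.symm.map_adj_iff.2 huv

theorem FinGraph.entCopsWin_ent (X : FinGraph) : EntCopsWin X.G.Adj X.ent :=
  Nat.sInf_mem (s := {k | EntCopsWin X.G.Adj k}) ⟨_, entCopsWin_card _⟩

/-- If a finite undirected graph `G` is a direct minor of a finite undirected
graph `H` (i.e. obtained from `H` by a single edge deletion, edge
contraction, or deletion of an isolated vertex), then
`Ent(H) - 1 ≤ Ent(G)`. -/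
theorem ent_le_directMinor_ent_add_one (G H : FinGraph) (h : G.DirectMinor H) :
    H.ent - 1 ≤ G.ent := by
  obtain ⟨a, f, hf, hadj⟩ := h.exists_vertex_deletion
  have hwin : EntCopsWin H.G.Adj (G.ent + 1) :=
    (G.entCopsWin_ent.of_injective hf hadj).of_subtype
  have : H.ent ≤ G.ent + 1 := Nat.sInf_le hwin
  omega
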